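/- Let V be a finite-dimensional real vector space equipped with a nondegenerate symmetric bilinear form B, let K ⊆ V be an isotropic subspace, and let L ⊆ V be a lagrangian subspace (L = L⊥). Then the subspaces T, R of the decomposition can be chosen compatibly with L: there exist subspaces T, R ⊆ V such that T is isotropic, V = K⊥ ⊕ T, R = (K + T)⊥, K⊥ = K ⊕ R, V = R ⊕ K ⊕ T, the restriction of B to R is nondegenerate, the pairing K × T → ℝ, (k,t) ↦ B(k,t), is perfect, and in addition L = (L ∩ R) ⊕ (L ∩ K) ⊕ (L ∩ T). -/

import Mathlib

/-- The `B`-orthogonal of a subspace `S`: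
`orthB B S = {v | ∀ s ∈ S, B v s = 0}`. -/
def orthB {V : Type*} [AddCommGroup V] [Module ℝ V]
    (B : V →ₗ[ℝ] V →ₗ[ℝ] ℝ) (S : Submodule ℝ V) : Submodule ℝ V :=
  ⨅ s ∈ S, LinearMap.ker (B.flip s)

section OrthB

variable {V : Type*} [AddCommGroup V] [Module ℝ V] {B : V →ₗ[ℝ] V →ₗ[ℝ] ℝ}

theorem mem_orthB {S : Submodule ℝ V} {v : V} : v ∈ orthB B S ↔ ∀ s ∈ S, B v s = 0 := by
  simp [orthB, Submodule.mem_iInf]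

theorem orthB_eq_orthogonal (hsymm : ∀ x y : V, B x y = B y x) (S : Submodule ℝ V) :
    orthB B S = LinearMap.BilinForm.orthogonal B S := by
  ext v
  rw [mem_orthB, LinearMap.BilinForm.mem_orthogonal_iff]
  exact forall₂_congr fun s _ => by rw [hsymm]

theorem isRefl_of_symm (hsymm : ∀ x y : V, B x y = B y x) : LinearMap.BilinForm.IsRefl B :=
  fun x y h => by rw [hsymm, h]

theorem orthB_orthB [FiniteDimensional ℝ V] (hsymm : ∀ x y : V, B x y = B y x)
    (hnd : ∀ x : V, (∀ y : V, B x y = 0) → x = 0) (S : Submodule ℝ V) :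
    orthB B (orthB B S) = S := by
  rw [orthB_eq_orthogonal hsymm, orthB_eq_orthogonal hsymm]
  exact LinearMap.BilinForm.orthogonal_orthogonal
    ((LinearMap.IsRefl.nondegenerate_iff_separatingLeft (isRefl_of_symm hsymm)).2 hnd)
    (isRefl_of_symm hsymm) S

theorem sup_orthB_eq_top [FiniteDimensional ℝ V] (hsymm : ∀ x y : V, B x y = B y x)
    {S : Submodule ℝ V} (h : Disjoint S (orthB B S)) : S ⊔ orthB B S = ⊤ := by
  rw [orthB_eq_orthogonal hsymm] at h ⊢
  exact ((LinearMap.BilinForm.isCompl_orthogonal_iff_disjoint (isRefl_of_symm hsymm)).2 h).sup_eq_top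

/-- If `T` is isotropic, disjoint from `K⊥`, but not a complement of it, then `T` can be enlarged
to an isotropic subspace that is still disjoint from `K⊥`. -/
theorem exists_isotropic_gt [FiniteDimensional ℝ V] (hsymm : ∀ x y : V, B x y = B y x)
    (hnd : ∀ x : V, (∀ y : V, B x y = 0) → x = 0) {K T : Submodule ℝ V} (hK : K ≤ orthB B K)
    (hT : T ≤ orthB B T) (hKT : Disjoint (orthB B K) T) (htop : orthB B K ⊔ T ≠ ⊤) :
    ∃ T' : Submodule ℝ V, T < T' ∧ T' ≤ orthB B T' ∧ Disjoint (orthB B K) T' := by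
  have hne : orthB B (orthB B K ⊔ T) ≠ ⊥ := by
    intro h
    apply htop
    rw [← orthB_orthB hsymm hnd (orthB B K ⊔ T), h, eq_top_iff]
    intro x _
    simp [mem_orthB]
  obtain ⟨k, hk, hk0⟩ := Submodule.exists_mem_ne_zero_of_ne_bot hne
  rw [mem_orthB] at hk
  have hkK : k ∈ K := by
    rw [← orthB_orthB hsymm hnd K, mem_orthB]
    exact fun s hs => hk s (Submodule.mem_sup_left hs)
  have hkT : ∀ t ∈ T, B k t = 0 := fun t ht => hk t (Submodule.mem_sup_right ht)
  have hkk : B k k = 0 := mem_orthB.1 (hK hkK) k hkK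
  obtain ⟨v, hvT, hvk⟩ : ∃ v ∈ orthB B T, B v k ≠ 0 := by
    by_contra! h
    refine hk0 (Submodule.disjoint_def.1 hKT k (hK hkK) ?_)
    rw [← orthB_orthB hsymm hnd T, mem_orthB]
    exact fun s hs => by rw [hsymm, h s hs]
  rw [mem_orthB] at hvT
  obtain ⟨w, hwT, hwk, hww⟩ : ∃ w : V, (∀ t ∈ T, B w t = 0) ∧ B w k ≠ 0 ∧ B w w = 0 := by
    refine ⟨v - (B v v / (2 * B v k)) • k, fun t ht => ?_, ?_, ?_⟩
    · simp [hvT t ht, hkT t ht]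
    · simpa [hkk] using hvk
    · simp only [map_sub, map_smul, LinearMap.sub_apply, LinearMap.smul_apply, smul_eq_mul, hkk,
        hsymm k v]
      field_simp
      ring
  have hdisj : ∀ t ∈ T, ∀ a : ℝ, t + a • w ∈ orthB B K → a = 0 ∧ t = 0 := by
    intro t ht a h
    have h0 := mem_orthB.1 h k hkK
    rw [map_add, LinearMap.add_apply, hsymm t, hkT t ht] at h0
    have ha : a = 0 := by simpa [hwk] using h0
    subst ha
    exact ⟨rfl, Submodule.disjoint_def.1 hKT t (by simpa using h) ht⟩
  refine ⟨T ⊔ Submodule.span ℝ {w}, lt_of_le_of_ne le_sup_left fun h => ?_, fun x hx => ?_, ?_⟩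
  · have hw : w ∈ T := by
      rw [h]
      exact Submodule.mem_sup_right (Submodule.mem_span_singleton_self w)
    exact hwk (by rw [hsymm, hkT w hw])
  · rw [mem_orthB]
    intro y hy
    obtain ⟨t, ht, _, hz, rfl⟩ := Submodule.mem_sup.1 hx
    obtain ⟨a, rfl⟩ := Submodule.mem_span_singleton.1 hz
    obtain ⟨s, hs, _, hz', rfl⟩ := Submodule.mem_sup.1 hy
    obtain ⟨b, rfl⟩ := Submodule.mem_span_singleton.1 hz'
    simp [hwT s hs, hsymm t w, hwT t ht, hww, mem_orthB.1 (hT ht) s hs]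
  · rw [Submodule.disjoint_def]
    intro x hx hx'
    obtain ⟨t, ht, _, hz, rfl⟩ := Submodule.mem_sup.1 hx'
    obtain ⟨a, rfl⟩ := Submodule.mem_span_singleton.1 hz
    obtain ⟨rfl, rfl⟩ := hdisj t ht a hx
    simp

/-- An isotropic subspace disjoint from `K⊥` extends to an isotropic complement of `K⊥`. -/
theorem exists_isotropic_isCompl [FiniteDimensional ℝ V] (hsymm : ∀ x y : V, B x y = B y x)
    (hnd : ∀ x : V, (∀ y : V, B x y = 0) → x = 0) {K S : Submodule ℝ V} (hK : K ≤ orthB B K)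
    (hS : S ≤ orthB B S) (hKS : Disjoint (orthB B K) S) :
    ∃ T : Submodule ℝ V, S ≤ T ∧ T ≤ orthB B T ∧ IsCompl (orthB B K) T := by
  obtain ⟨T, ⟨hST, hT, hKT⟩, hmax⟩ := (wellFounded_gt (α := Submodule ℝ V)).has_min
    {T | S ≤ T ∧ T ≤ orthB B T ∧ Disjoint (orthB B K) T} ⟨S, le_rfl, hS, hKS⟩
  refine ⟨T, hST, hT, hKT, codisjoint_iff.2 ?_⟩
  by_contra htop
  obtain ⟨T', hlt, hT', hKT'⟩ := exists_isotropic_gt hsymm hnd hK hT hKT htop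
  exact hmax T' ⟨hST.trans hlt.le, hT', hKT'⟩ hlt

end OrthB

theorem stmt9
    {V : Type*} [AddCommGroup V] [Module ℝ V] [FiniteDimensional ℝ V]
    (B : V →ₗ[ℝ] V →ₗ[ℝ] ℝ)
    (hsymm : ∀ x y : V, B x y = B y x)
    (hnd : ∀ x : V, (∀ y : V, B x y = 0) → x = 0)
    (K : Submodule ℝ V) (hK : K ≤ orthB B K)
    -- L is lagrangian
    (L : Submodule ℝ V) (hL : L = orthB B L) :
    ∃ T R : Submodule ℝ V,
      -- T is isotropic
      T ≤ orthB B T ∧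
      -- V = K⊥ ⊕ T
      IsCompl (orthB B K) T ∧
      -- R = (K + T)⊥
      R = orthB B (K ⊔ T) ∧
      -- K⊥ = K ⊕ R
      (orthB B K = K ⊔ R ∧ K ⊓ R = ⊥) ∧
      -- V = R ⊕ K ⊕ T
      (R ⊔ (K ⊔ T) = ⊤ ∧ R ⊓ (K ⊔ T) = ⊥ ∧ K ⊓ T = ⊥) ∧
      -- the restriction of B to R is nondegenerate
      (∀ r ∈ R, (∀ r' ∈ R, B r r' = 0) → r = 0) ∧
      -- the pairing K × T → ℝ is perfect
      (∀ k ∈ K, (∀ t ∈ T, B k t = 0) → k = 0) ∧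
      (∀ t ∈ T, (∀ k ∈ K, B k t = 0) → t = 0) ∧
      -- L decomposes compatibly
      L = (L ⊓ R) ⊔ (L ⊓ K) ⊔ (L ⊓ T) := by
  have hLL : ∀ x ∈ L, ∀ y ∈ L, B x y = 0 := fun x hx => mem_orthB.1 (hL ▸ hx)
  obtain ⟨C, hC⟩ := Submodule.exists_isCompl (L ⊓ orthB B K)
  obtain ⟨T, hST, hT, hKT⟩ := exists_isotropic_isCompl hsymm hnd (S := C ⊓ L) hK
    (fun x hx => mem_orthB.2 fun y hy => hLL x hx.2 y hy.2)
    (Submodule.disjoint_def.2 fun x hx hx' =>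
      Submodule.disjoint_def.1 hC.disjoint x ⟨hx'.2, hx⟩ hx'.1)
  have hLdec : ∀ x ∈ L, ∃ y ∈ L ⊓ orthB B K, ∃ t ∈ L ⊓ T, y + t = x := by
    intro x hx
    obtain ⟨y, hy, t, ht, rfl⟩ := Submodule.mem_sup.1
      (hC.sup_eq_top ▸ Submodule.mem_top : x ∈ L ⊓ orthB B K ⊔ C)
    have htL : t ∈ L := by simpa using L.sub_mem hx hy.1
    exact ⟨y, hy, t, ⟨htL, hST ⟨ht, htL⟩⟩, rfl⟩
  have hperfK : ∀ k ∈ K, (∀ t ∈ T, B k t = 0) → k = 0 := by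
    intro k hk h
    refine hnd k fun y => ?_
    obtain ⟨a, ha, t, ht, rfl⟩ := Submodule.mem_sup.1
      (hKT.sup_eq_top ▸ Submodule.mem_top : y ∈ orthB B K ⊔ T)
    rw [map_add, h t ht, hsymm, mem_orthB.1 ha k hk, add_zero]
  have hperfT : ∀ t ∈ T, (∀ k ∈ K, B k t = 0) → t = 0 := fun t ht h =>
    Submodule.disjoint_def.1 hKT.disjoint t (mem_orthB.2 fun k hk => by rw [hsymm, h k hk]) ht
  have hdisj : Disjoint (K ⊔ T) (orthB B (K ⊔ T)) := by
    rw [Submodule.disjoint_def]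
    intro x hx hx'
    rw [mem_orthB] at hx'
    obtain ⟨k, hk, t, ht, rfl⟩ := Submodule.mem_sup.1 hx
    obtain rfl : t = 0 := hperfT t ht fun k' hk' => by
      have h := hx' k' (Submodule.mem_sup_left hk')
      rwa [map_add, LinearMap.add_apply, mem_orthB.1 (hK hk) k' hk', zero_add, hsymm] at h
    rw [add_zero] at hx' ⊢
    exact hperfK k hk fun t' ht' => hx' t' (Submodule.mem_sup_right ht')
  have htop := sup_orthB_eq_top hsymm hdisj
  have hRK : orthB B (K ⊔ T) ≤ orthB B K := fun r hr =>
    mem_orthB.2 fun k hk => mem_orthB.1 hr k (Submodule.mem_sup_left hk)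
  have hKR : orthB B K = K ⊔ orthB B (K ⊔ T) := by
    refine le_antisymm (fun x hx => ?_) (sup_le hK hRK)
    obtain ⟨y, hy, r, hr, rfl⟩ := Submodule.mem_sup.1
      (htop ▸ Submodule.mem_top : x ∈ (K ⊔ T) ⊔ orthB B (K ⊔ T))
    obtain ⟨k, hk, t, ht, rfl⟩ := Submodule.mem_sup.1 hy
    obtain rfl : t = 0 := by
      refine Submodule.disjoint_def.1 hKT.disjoint t ?_ ht
      have h := (orthB B K).sub_mem ((orthB B K).sub_mem hx (hRK hr)) (hK hk)
      simpa using h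
    exact Submodule.mem_sup.2 ⟨k, hk, r, hr, by simp⟩
  refine ⟨T, orthB B (K ⊔ T), hT, hKT, rfl, ⟨hKR, ?_⟩, ⟨?_, hdisj.symm.eq_bot, ?_⟩, ?_,
    hperfK, hperfT, ?_⟩
  · exact (hdisj.mono_left le_sup_left).eq_bot
  · rw [sup_comm, htop]
  · exact (hKT.disjoint.mono_left hK).eq_bot
  · intro r hr h
    refine hnd r fun y => ?_
    obtain ⟨a, ha, r', hr', rfl⟩ := Submodule.mem_sup.1
      (htop ▸ Submodule.mem_top : y ∈ (K ⊔ T) ⊔ orthB B (K ⊔ T))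
    rw [map_add, mem_orthB.1 hr a ha, h r' hr', add_zero]
  · refine le_antisymm (fun x hx => ?_) (sup_le (sup_le inf_le_left inf_le_left) inf_le_left)
    obtain ⟨y, ⟨hyL, hyK⟩, t, ht, rfl⟩ := hLdec x hx
    obtain ⟨k, hk, r, hr, rfl⟩ := Submodule.mem_sup.1 (hKR ▸ hyK)
    have hkL : k ∈ L := by
      rw [hL, mem_orthB]
      intro l hl
      obtain ⟨z, hz, s, hs, rfl⟩ := hLdec l hl
      have h := hLL _ hyL s hs.1
      rw [map_add, LinearMap.add_apply, mem_orthB.1 hr s (Submodule.mem_sup_right hs.2),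
        add_zero] at h
      rw [map_add, h, hsymm, mem_orthB.1 hz.2 k hk, add_zero]
    have hrL : r ∈ L := by simpa using L.sub_mem hyL hkL
    refine Submodule.add_mem_sup ?_ ht
    rw [add_comm]
    exact Submodule.add_mem_sup ⟨hrL, hr⟩ ⟨hkL, hk⟩
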